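/- arXiv:2209.08437 — 3 statements merged into one kernel-verified Lean document; each statement's English description precedes it below -/
import Mathlib

section
/- Let α ∈ (1,2). Then 1 ≥ ω_0^{(α)} ≥ ω_3^{(α)}, and for every integer k ≥ 3 one has ω_k^{(α)} ≥ ω_{k+1}^{(α)} ≥ 0; that is, 1 ≥ ω_0^{(α)} ≥ ω_3^{(α)} ≥ ω_4^{(α)} ≥ ⋯ ≥ 0. -/
/-- The coefficients `g_k^{(α)}`: `g_0 = 1`, `g_{k+1} = (1 - (α+1)/(k+1)) g_k`. -/
noncomputable def gcoef (α : ℝ) : ℕ → ℝ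
  | 0 => 1
  | k + 1 => (1 - (α + 1) / ((k : ℝ) + 1)) * gcoef α k

/-- The coefficients `ω_k^{(α)}`: `ω_0 = (α/2) g_0`,
`ω_{k+1} = (α/2) g_{k+1} + ((2-α)/2) g_k`. -/
noncomputable def ω (α : ℝ) : ℕ → ℝ
  | 0 => α / 2 * gcoef α 0
  | k + 1 => α / 2 * gcoef α (k + 1) + (2 - α) / 2 * gcoef α k

theorem gcoef_nonneg {α : ℝ} (hα1 : 1 < α) (hα2 : α < 2) (m : ℕ) : 0 ≤ gcoef α (m + 2) := by
  induction m with
  | zero =>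
    norm_num [gcoef]
    nlinarith
  | succ m ih =>
    rw [gcoef]
    refine mul_nonneg ?_ ih
    have hm : (0 : ℝ) ≤ m := m.cast_nonneg
    rw [sub_nonneg, div_le_one (by positivity)]
    push_cast
    linarith

theorem ω_succ (α : ℝ) (k : ℕ) :
    ω α (k + 1) = (1 - α * (α + 1) / 2 / ((k : ℝ) + 1)) * gcoef α k := by
  rw [ω, gcoef]
  ring

theorem ω_nonneg {α : ℝ} (hα1 : 1 < α) (hα2 : α < 2) (m : ℕ) : 0 ≤ ω α (m + 3) := by
  rw [ω_succ]
  refine mul_nonneg ?_ (gcoef_nonneg hα1 hα2 m)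
  have hm : (0 : ℝ) ≤ m := m.cast_nonneg
  rw [sub_nonneg, div_le_one (by positivity)]
  push_cast
  nlinarith

theorem ω_succ_le {α : ℝ} (hα1 : 1 < α) (hα2 : α < 2) (m : ℕ) : ω α (m + 4) ≤ ω α (m + 3) := by
  rw [ω_succ, ω_succ, gcoef, ← mul_assoc]
  refine mul_le_mul_of_nonneg_right ?_ (gcoef_nonneg hα1 hα2 m)
  have hm : (0 : ℝ) ≤ m := m.cast_nonneg
  push_cast
  rw [← sub_nonneg]
  have h : 1 - α * (α + 1) / 2 / ((m : ℝ) + 2 + 1) -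
      (1 - α * (α + 1) / 2 / ((m : ℝ) + 3 + 1)) * (1 - (α + 1) / ((m : ℝ) + 2 + 1)) =
      (α + 1) * (m + 4 - α * (α + 1) / 2 - α / 2) / ((m + 3) * (m + 4)) := by
    field_simp
    ring
  rw [h]
  have : 0 ≤ (m : ℝ) + 4 - α * (α + 1) / 2 - α / 2 := by nlinarith
  positivity

theorem stmt1 (α : ℝ) (hα1 : 1 < α) (hα2 : α < 2) :
    1 ≥ ω α 0 ∧ ω α 0 ≥ ω α 3 ∧
    ∀ k : ℕ, 3 ≤ k → ω α k ≥ ω α (k + 1) ∧ ω α (k + 1) ≥ 0 := by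
  refine ⟨?_, ?_, fun k hk => ?_⟩
  · norm_num [ω, gcoef]
    linarith
  · rw [ω_succ]
    norm_num [ω, gcoef]
    have h : 0 ≤ α * (α + 1) := by nlinarith
    have hg : 0 ≤ α * (α - 1) / 2 := by nlinarith
    nlinarith [mul_nonneg h hg]
  · obtain ⟨m, rfl⟩ := Nat.exists_eq_add_of_le' hk
    exact ⟨ω_succ_le hα1 hα2 m, ω_nonneg hα1 hα2 (m + 1)⟩
end

section
/- Let α ∈ (1,2). Then the series ∑_{k=0}^{∞} ω_k^{(α)} converges and its sum equals 0 (i.e., the sequence k ↦ ω_k^{(α)} has sum 0). -/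
theorem gcoef_succ_mul (α : ℝ) (n : ℕ) :
    ((n : ℝ) + 1) * gcoef α (n + 1) = (n - α) * gcoef α n := by
  have h : (n : ℝ) + 1 ≠ 0 := by positivity
  rw [gcoef]
  field_simp
  ring

theorem mul_sum_range_gcoef (α : ℝ) (n : ℕ) :
    α * ∑ k ∈ Finset.range n, gcoef α k = -(n * gcoef α n) := by
  induction n with
  | zero => simp
  | succ n ih =>
    rw [Finset.sum_range_succ, mul_add, ih]
    push_cast
    rw [gcoef_succ_mul]
    ring

theorem gcoef_two (α : ℝ) : gcoef α 2 = α * (α - 1) / 2 := by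
  simp only [gcoef]
  norm_num
  ring

theorem gcoef_add_two_nonneg {α : ℝ} (hα1 : 1 ≤ α) (hα2 : α ≤ 2) (n : ℕ) :
    0 ≤ gcoef α (n + 2) := by
  induction n with
  | zero =>
    rw [zero_add, gcoef_two]
    have := mul_nonneg (zero_le_one.trans hα1) (sub_nonneg.2 hα1)
    positivity
  | succ n ih =>
    have h := gcoef_succ_mul α (n + 2)
    push_cast at h
    have hn : (0 : ℝ) ≤ n := n.cast_nonneg
    refine nonneg_of_mul_nonneg_right (a := (n : ℝ) + 2 + 1) ?_ (by positivity)
    exact h ▸ mul_nonneg (by linarith) ih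

theorem mul_gcoef_add_two_le {α : ℝ} (hα1 : 1 ≤ α) (hα2 : α ≤ 2) (n : ℕ) :
    ((n : ℝ) + 1) * ((n + 2) * gcoef α (n + 2)) ≤ α * (α - 1) := by
  induction n with
  | zero =>
    rw [zero_add, gcoef_two]
    norm_num
    linarith
  | succ n ih =>
    have h := gcoef_succ_mul α (n + 2)
    push_cast at h ⊢
    have hg := gcoef_add_two_nonneg hα1 hα2 n
    rw [show n + 1 + 2 = n + 2 + 1 by ring,
      show ((n : ℝ) + 1 + 2) = n + 2 + 1 by ring, h]
    have : 0 ≤ ((n : ℝ) + 2) * (α - 1) * gcoef α (n + 2) :=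
      mul_nonneg (mul_nonneg (by positivity) (by linarith)) hg
    linarith

theorem tendsto_mul_gcoef {α : ℝ} (hα1 : 1 ≤ α) (hα2 : α ≤ 2) :
    Filter.Tendsto (fun n : ℕ => (n : ℝ) * gcoef α n) Filter.atTop (nhds 0) := by
  rw [← Filter.tendsto_add_atTop_iff_nat 2]
  have hlim : Filter.Tendsto (fun n : ℕ => α * (α - 1) * (1 / ((n : ℝ) + 1)))
      Filter.atTop (nhds 0) := by
    simpa using tendsto_one_div_add_atTop_nhds_zero_nat.const_mul (α * (α - 1))
  refine squeeze_zero (fun n => ?_) (fun n => ?_) hlim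
  · exact mul_nonneg (Nat.cast_nonneg _) (gcoef_add_two_nonneg hα1 hα2 n)
  · have h : (0 : ℝ) < n + 1 := by positivity
    rw [mul_one_div, le_div_iff₀ h, mul_comm]
    exact_mod_cast mul_gcoef_add_two_le hα1 hα2 n

theorem hasSum_gcoef {α : ℝ} (hα1 : 1 ≤ α) (hα2 : α ≤ 2) : HasSum (gcoef α) 0 := by
  have hα : α ≠ 0 := by linarith
  have hsum : Filter.Tendsto (fun n => ∑ k ∈ Finset.range n, gcoef α k)
      Filter.atTop (nhds 0) := by
    have h := ((tendsto_mul_gcoef hα1 hα2).neg).div_const α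
    rw [neg_zero, zero_div] at h
    refine h.congr fun n => ?_
    rw [← mul_sum_range_gcoef, mul_div_cancel_left₀ _ hα]
  rw [← hasSum_nat_add_iff' 2,
    hasSum_iff_tendsto_nat_of_nonneg (gcoef_add_two_nonneg hα1 hα2)]
  refine (((Filter.tendsto_add_atTop_iff_nat 2).2 hsum).sub_const _).congr fun n => ?_
  rw [add_comm n 2, Finset.sum_range_add, add_sub_cancel_left]
  simp only [add_comm 2]

theorem stmt2 (α : ℝ) (hα1 : 1 < α) (hα2 : α < 2) :
    HasSum (fun k : ℕ => ω α k) 0 := by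
  have hg := hasSum_gcoef hα1.le hα2.le
  have hs := ((hasSum_nat_add_iff' 1).2 hg).mul_left (α / 2)
  rw [← hasSum_nat_add_iff' 1]
  have hval : 0 - ∑ i ∈ Finset.range 1, ω α i =
      α / 2 * (0 - ∑ i ∈ Finset.range 1, gcoef α i) + (2 - α) / 2 * 0 := by
    simp [ω]
  rw [hval]
  exact hs.add (hg.mul_left ((2 - α) / 2))
end

section
/- For every τ ≥ 0 and all v, w ∈ ℝ^m with ‖v‖_∞ ≤ 1 and ‖w‖_∞ ≤ 1, the nonlinear solution operator satisfies the Lipschitz bound ‖J^Q_τ v − J^Q_τ w‖_∞ ≤ e^{τ} ‖v − w‖_∞. -/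
/-- The nonlinear solution operator `J^Q_τ`, acting componentwise by
`v_i ↦ v_i / sqrt(v_i² + (1 - v_i²) e^{-2τ})`. -/
noncomputable def JQ {m : ℕ} (τ : ℝ) (v : Fin m → ℝ) : Fin m → ℝ :=
  fun i => v i / Real.sqrt ((v i) ^ 2 + (1 - (v i) ^ 2) * Real.exp (-2 * τ))

theorem hasDerivAt_div_sqrt {b : ℝ} (hb : 0 < b) (hb1 : b ≤ 1) (x : ℝ) :
    HasDerivAt (fun y : ℝ => y / √(y ^ 2 + (1 - y ^ 2) * b ^ 2))
      (b ^ 2 / √(x ^ 2 + (1 - x ^ 2) * b ^ 2) ^ 3) x := by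
  have hb2 : b ^ 2 ≤ 1 := pow_le_one₀ hb.le hb1
  have hD : 0 < x ^ 2 + (1 - x ^ 2) * b ^ 2 := by
    nlinarith [mul_nonneg (sq_nonneg x) (sub_nonneg.2 hb2), pow_pos hb 2]
  have hs := Real.sqrt_pos.2 hD
  have hss := Real.sq_sqrt hD.le
  have hpow : HasDerivAt (fun y : ℝ => y ^ 2) (2 * x) x := by
    simpa using hasDerivAt_pow 2 x
  have hinner := (hpow.add ((hpow.const_sub 1).mul_const (b ^ 2))).sqrt hD.ne'
  refine ((hasDerivAt_id x).div hinner hs.ne').congr_deriv ?_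
  simp only [id, Pi.add_apply]
  set s := √(x ^ 2 + (1 - x ^ 2) * b ^ 2)
  field_simp
  linear_combination hss

theorem norm_div_sqrt_sub_le {b : ℝ} (hb : 0 < b) (hb1 : b ≤ 1) (x y : ℝ) :
    ‖x / √(x ^ 2 + (1 - x ^ 2) * b ^ 2) - y / √(y ^ 2 + (1 - y ^ 2) * b ^ 2)‖
      ≤ b⁻¹ * ‖x - y‖ := by
  refine Convex.norm_image_sub_le_of_norm_hasDerivWithin_le
    (f := fun z : ℝ => z / √(z ^ 2 + (1 - z ^ 2) * b ^ 2))
    (fun z _ => (hasDerivAt_div_sqrt hb hb1 z).hasDerivWithinAt) (fun z _ => ?_)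
    convex_univ (Set.mem_univ y) (Set.mem_univ x)
  have hb2 : b ^ 2 ≤ 1 := pow_le_one₀ hb.le hb1
  have hs : b ≤ √(z ^ 2 + (1 - z ^ 2) * b ^ 2) := by
    apply Real.le_sqrt_of_sq_le
    nlinarith [mul_nonneg (sq_nonneg z) (sub_nonneg.2 hb2)]
  rw [Real.norm_of_nonneg (by positivity)]
  calc b ^ 2 / √(z ^ 2 + (1 - z ^ 2) * b ^ 2) ^ 3 ≤ b ^ 2 / b ^ 3 := by gcongr
    _ = b⁻¹ := by field_simp

theorem stmt13 (m : ℕ) (τ : ℝ) (hτ : 0 ≤ τ) (v w : Fin m → ℝ)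
    (hv : ‖v‖ ≤ 1) (hw : ‖w‖ ≤ 1) :
    ‖JQ τ v - JQ τ w‖ ≤ Real.exp τ * ‖v - w‖ := by
  refine (pi_norm_le_iff_of_nonneg (by positivity)).2 fun i => ?_
  have hexp : Real.exp (-2 * τ) = Real.exp (-τ) ^ 2 := by
    rw [← Real.exp_nat_mul]
    congr 1
    push_cast
    ring
  have h := norm_div_sqrt_sub_le (Real.exp_pos (-τ))
    (Real.exp_le_one_iff.2 (neg_nonpos.2 hτ)) (v i) (w i)
  rw [← Real.exp_neg, neg_neg, ← hexp] at h
  refine h.trans ?_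
  gcongr
  exact norm_le_pi_norm (v - w) i
end
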